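/- Let p, k, d be positive integers with k ≤ p, and let t ∈ ℝ. Let x, x' be independent draws from the Bernoulli–Rademacher prior on ℝ^p with sparsity k, and let y, y' be independent draws from the Bernoulli prior on ℝ^p with sparsity k. Then Pr[⟨x, x'⟩^d ≥ t] ≤ Pr[⟨y, y'⟩^d ≥ t]. -/

import Mathlib

open MeasureTheory ProbabilityTheory Filter Real
open scoped ENNReal NNReal

noncomputable section

/-- Vectors in `ℝ^p`. -/
abbrev V (p : ℕ) : Type := Fin p → ℝ

/-- Euclidean inner product on `ℝ^p`. -/
def inp {p : ℕ} (x y : V p) : ℝ := ∑ i, x i * y i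

/-- The uniform probability measure on a finite set of vectors. -/
def unifOn {p : ℕ} (S : Finset (V p)) : Measure (V p) :=
  (S.card : ℝ≥0∞)⁻¹ • ∑ x ∈ S, Measure.dirac x

/-- The support of the Bernoulli prior with sparsity `k`: the vectors in `{0, 1/√k}^p`
having exactly `k` nonzero entries. -/
def bernSupport (p k : ℕ) : Finset (V p) := by
  classical
  exact (Finset.univ.powersetCard k).image
    fun A => fun i => if i ∈ A then (Real.sqrt k)⁻¹ else 0

/-- The support of the Bernoulli–Rademacher prior with sparsity `k`: the vectors in
`{-1/√k, 0, 1/√k}^p` having exactly `k` nonzero entries. -/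
def brSupport (p k : ℕ) : Finset (V p) := by
  classical
  exact ((Finset.univ.powersetCard k) ×ˢ (Finset.univ : Finset (Fin p → Bool))).image
    fun q => fun i =>
      if i ∈ q.1 then (if q.2 i then (Real.sqrt k)⁻¹ else -(Real.sqrt k)⁻¹) else 0

def absV {p : ℕ} (x : V p) : V p := fun i => |x i|

lemma measurable_absV {p : ℕ} : Measurable (absV (p := p)) := by
  unfold absV
  refine measurable_pi_lambda _ fun i => ?_
  exact continuous_abs.measurable.comp (measurable_pi_apply i)

lemma mem_bern {p k : ℕ} {y : V p} : y ∈ bernSupport p k ↔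
    ∃ A : Finset (Fin p), A.card = k ∧ y = fun i => if i ∈ A then (Real.sqrt k)⁻¹ else 0 := by
  classical
  simp only [bernSupport, Finset.mem_image, Finset.mem_powersetCard, Finset.subset_univ, true_and]
  constructor
  · rintro ⟨A, h, rfl⟩
    exact ⟨A, h, by ext i; congr⟩
  · rintro ⟨A, h, rfl⟩
    exact ⟨A, h, by ext i; congr⟩

lemma mem_br {p k : ℕ} {y : V p} : y ∈ brSupport p k ↔
    ∃ (A : Finset (Fin p)) (s : Fin p → Bool), A.card = k ∧ y = fun i =>
      if i ∈ A then (if s i then (Real.sqrt k)⁻¹ else -(Real.sqrt k)⁻¹) else 0 := by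
  classical
  simp only [brSupport, Finset.mem_image, Finset.mem_product, Finset.mem_powersetCard,
    Finset.subset_univ, true_and, Finset.mem_univ, and_true, Prod.exists]
  constructor
  · rintro ⟨A, s, h, rfl⟩
    exact ⟨A, s, h, by ext i; congr⟩
  · rintro ⟨A, s, h, rfl⟩
    exact ⟨A, s, h, by ext i; congr⟩

lemma absV_mem {p k : ℕ} {x : V p} (hx : x ∈ brSupport p k) : absV x ∈ bernSupport p k := by
  obtain ⟨A, s, hA, rfl⟩ := mem_br.1 hx
  refine mem_bern.2 ⟨A, hA, ?_⟩
  have h0 : 0 ≤ (Real.sqrt k)⁻¹ := by positivity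
  ext i
  simp only [absV]
  split_ifs <;> simp [abs_of_nonneg]

open Classical in
lemma fiber_eq {p k : ℕ} {y : V p} (hy : y ∈ bernSupport p k) :
    (brSupport p k).filter (fun x => absV x = y) =
      Fintype.piFinset (fun i => ({y i, -y i} : Finset ℝ)) := by
  obtain ⟨A, hA, rfl⟩ := mem_bern.1 hy
  have h0 : 0 ≤ (Real.sqrt k)⁻¹ := by positivity
  ext x
  simp only [Finset.mem_filter, Fintype.mem_piFinset, Finset.mem_insert, Finset.mem_singleton]
  constructor
  · rintro ⟨-, h⟩ i
    have := congrFun h i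
    rw [← this]
    simp only [absV]
    rcases abs_choice (x i) with h | h <;> rw [h] <;> simp
  · intro h
    constructor
    · refine mem_br.2 ⟨A, fun i => decide (x i = (Real.sqrt k)⁻¹), hA, ?_⟩
      ext i
      have := h i
      by_cases hi : i ∈ A <;> simp only [hi, if_true, if_false] at this ⊢
      · by_cases hx : x i = (Real.sqrt k)⁻¹
        · simp [hx]
        · simp only [hx, decide_false]
          simpa [hx] using this
      · simpa using this
    · ext i
      have := h i
      simp only [absV]
      by_cases hi : i ∈ A <;> simp only [hi, if_true, if_false] at this ⊢
      · rcases this with h | h <;> rw [h]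
        · exact abs_of_nonneg h0
        · rw [abs_neg]; exact abs_of_nonneg h0
      · simpa using this

open Classical in
lemma fiber_card {p k : ℕ} (hk : 1 ≤ k) {y : V p} (hy : y ∈ bernSupport p k) :
    ((brSupport p k).filter (fun x => absV x = y)).card = 2 ^ k := by
  rw [fiber_eq hy, Fintype.card_piFinset]
  obtain ⟨A, hA, rfl⟩ := mem_bern.1 hy
  have h0 : 0 < (Real.sqrt k)⁻¹ := by
    have : (0 : ℝ) < k := by exact_mod_cast hk
    positivity
  have : ∀ i : Fin p, ({(if i ∈ A then (Real.sqrt k)⁻¹ else 0),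
      -(if i ∈ A then (Real.sqrt k)⁻¹ else 0)} : Finset ℝ).card = if i ∈ A then 2 else 1 := by
    intro i
    by_cases hi : i ∈ A <;> simp only [hi, if_true, if_false]
    · exact Finset.card_pair (by linarith)
    · simp
  rw [Finset.prod_congr rfl fun i _ => this i]
  rw [Finset.prod_ite]
  simp [hA]

lemma map_br {p k : ℕ} (hk : 1 ≤ k) :
    (unifOn (brSupport p k)).map absV = unifOn (bernSupport p k) := by
  classical
  have hc : (brSupport p k).card = (bernSupport p k).card * 2 ^ k := by
    rw [Finset.card_eq_sum_card_fiberwise (f := absV) (t := bernSupport p k)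
      (fun x hx => absV_mem hx)]
    rw [Finset.sum_congr rfl fun y hy => fiber_card hk hy]
    simp
  have hs : (∑ x ∈ brSupport p k, Measure.dirac x).map absV
      = (2 ^ k : ℝ≥0∞) • ∑ y ∈ bernSupport p k, Measure.dirac y := by
    rw [← Measure.mapₗ_apply_of_measurable measurable_absV, map_sum]
    simp only [Measure.mapₗ_apply_of_measurable measurable_absV,
      Measure.map_dirac' measurable_absV]
    rw [← Finset.sum_fiberwise_of_maps_to (t := bernSupport p k) (g := absV)
      (fun x hx => absV_mem hx), Finset.smul_sum]
    refine Finset.sum_congr rfl fun y hy => ?_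
    rw [Finset.sum_congr rfl (g := fun _ => Measure.dirac y)
      (fun x hx => by rw [(Finset.mem_filter.1 hx).2]), Finset.sum_const, fiber_card hk hy]
    ext s _
    simp
  unfold unifOn
  rw [Measure.map_smul, hs, smul_smul, hc]
  congr 1
  push_cast
  rw [ENNReal.mul_inv (by simp) (by simp), mul_assoc, ENNReal.inv_mul_cancel (by simp) (by simp),
    mul_one]

instance {p : ℕ} (S : Finset (V p)) : SFinite (unifOn S) := by
  unfold unifOn; infer_instance

/-- stochastic domination step in Proposition 4 of the paper. For
positive integers `p, k, d` with `k ≤ p` and any `t ∈ ℝ`, the overlap tail probability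
under the Bernoulli–Rademacher prior is at most the one under the Bernoulli prior:
`Pr[⟨x,x'⟩^d ≥ t] ≤ Pr[⟨y,y'⟩^d ≥ t]`. -/
theorem statement17 (p k d : ℕ) (hk : 1 ≤ k) (hkp : k ≤ p) (hd : 1 ≤ d) (t : ℝ) :
    ((unifOn (brSupport p k)).prod (unifOn (brSupport p k)))
        {q | t ≤ (inp q.1 q.2) ^ d}
      ≤ ((unifOn (bernSupport p k)).prod (unifOn (bernSupport p k)))
        {q | t ≤ (inp q.1 q.2) ^ d} := by
  rw [← map_br (p := p) hk, Measure.map_prod_map _ _ measurable_absV measurable_absV]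
  have hm : Measurable fun q : V p × V p => inp q.1 q.2 := by
    unfold inp
    fun_prop
  rw [Measure.map_apply (measurable_absV.prodMap measurable_absV)
    (measurableSet_le measurable_const (hm.pow_const d))]
  refine measure_mono fun q hq => ?_
  simp only [Set.mem_setOf_eq, Set.mem_preimage, Prod.map_fst, Prod.map_snd] at hq ⊢
  have h : |inp q.1 q.2| ≤ inp (absV q.1) (absV q.2) := by
    unfold inp absV
    refine (Finset.abs_sum_le_sum_abs _ _).trans (le_of_eq ?_)
    simp [abs_mul]
  calc t ≤ _ := hq
    _ ≤ |inp q.1 q.2 ^ d| := le_abs_self _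
    _ = |inp q.1 q.2| ^ d := abs_pow _ _
    _ ≤ _ := pow_le_pow_left₀ (abs_nonneg _) h d
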